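/- arXiv:2309.17181 — 2 statements merged into one kernel-verified Lean document; each statement's English description precedes it below -/
import Mathlib

section
/- Fix n ≥ 1, 0 ≤ r ≤ s ≤ n, and nonzero complex numbers x₁, x₂, a, b₁, b₂ with a^m ≠ 1 for 1 ≤ m ≤ n, b₁ a^m ≠ 1 for 0 ≤ m ≤ n, x₂ b₁ ≠ x₁ b₂ a^m for |m| ≤ n, and x₂ ≠ x₁ b₂ a^m for |m| ≤ n. Then the alternating sums at the point η = η_r satisfy 𝒜(φ_s·D_a)(η) = [(x₂/x₁) b₂^{−1} a^{−r}]^{s−r} · [(b₁ a^{n−s};a)_{s−r} / ((x₂/x₁) b₁ b₂^{−1} a^{n−s−r};a)_{s−r}] · [(a;a)_s / ((a;a)_r·(a;a)_{s−r})] · 𝒜(φ_r·D_a)(η). (This is the off-diagonal/diagonal ratio c⁻_{A,rs}/c⁻_{A,rr} of Proposition 3.2, which is independent of q.) -/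
open Finset

/-- The q-Pochhammer symbol `(x;c)_m = ∏_{i=0}^{m-1} (1 - c^i x)`. -/
noncomputable def qPoch (x c : ℂ) (m : ℕ) : ℂ := ∏ i ∈ Finset.range m, (1 - c ^ i * x)

/-- The characteristic point `η = η_r ∈ ℂⁿ`: `η_i = x₁ b₁⁻¹ a^{−(i−1)}` for `1 ≤ i ≤ n−r`
and `η_{n−r+i} = x₂ b₂⁻¹ a^{−(i−1)}` for `1 ≤ i ≤ r` (indexed by `Fin n`, zero-based). -/
noncomputable def etaPt (n r : ℕ) (x₁ x₂ a b₁ b₂ : ℂ) (i : Fin n) : ℂ :=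
  if (i : ℕ) < n - r then x₁ * b₁⁻¹ * (a ^ (i : ℕ))⁻¹
  else x₂ * b₂⁻¹ * (a ^ ((i : ℕ) - (n - r)))⁻¹

/-- `φ_s(t₁,…,t_n) = ∏_{k=1}^{n−s}(1 − b₂ t_k/x₂) · ∏_{k=n−s+1}^{n}(1 − t_k/x₁)`. -/
noncomputable def phiFun (n s : ℕ) (x₁ x₂ b₂ : ℂ) (t : Fin n → ℂ) : ℂ :=
  (∏ i ∈ Finset.univ.filter (fun i : Fin n => (i : ℕ) < n - s), (1 - b₂ * t i / x₂)) *
    ∏ i ∈ Finset.univ.filter (fun i : Fin n => n - s ≤ (i : ℕ)), (1 - t i / x₁)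

/-- The alternating sum `𝒜(φ_s·D_a)(η_r)`. -/
noncomputable def AsumEta (n r s : ℕ) (x₁ x₂ a b₁ b₂ : ℂ) : ℂ :=
  ∑ σ : Equiv.Perm (Fin n),
    ((Equiv.Perm.sign σ : ℤ) : ℂ) *
      phiFun n s x₁ x₂ b₂ (fun i => etaPt n r x₁ x₂ a b₁ b₂ (σ i)) *
      ∏ p ∈ Finset.univ.filter (fun p : Fin n × Fin n => p.1 < p.2),
        (etaPt n r x₁ x₂ a b₁ b₂ (σ p.1) - a⁻¹ * etaPt n r x₁ x₂ a b₁ b₂ (σ p.2))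

/-! ### Auxiliary alternating sums -/

/-- General alternating sum with position-dependent weights. -/
noncomputable def genA (c : ℂ) (w : ℕ → ℂ → ℂ) (n : ℕ) (t : Fin n → ℂ) : ℂ :=
  ∑ σ : Equiv.Perm (Fin n), ((Equiv.Perm.sign σ : ℤ) : ℂ) *
    (∏ i : Fin n, w i (t (σ i))) * ∏ i : Fin n, ∏ j ∈ Finset.Ioi i, (t (σ i) - c * t (σ j))

/-- The Vandermonde product. -/
noncomputable def vdm (n : ℕ) (t : Fin n → ℂ) : ℂ :=
  ∏ i : Fin n, ∏ j ∈ Finset.Ioi i, (t i - t j)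

lemma vdm_perm (n : ℕ) (t : Fin n → ℂ) (σ : Equiv.Perm (Fin n)) :
    vdm n (fun i => t (σ i)) = ((Equiv.Perm.sign σ : ℤ) : ℂ) * vdm n t := by
  have key : ∀ u : Fin n → ℂ, vdm n u = (Matrix.vandermonde (fun i => - u i)).det := by
    intro u
    rw [Matrix.det_vandermonde, vdm]
    refine Finset.prod_congr rfl fun i _ => Finset.prod_congr rfl fun j _ => by ring
  rw [key, key, ← Matrix.det_permute]
  rfl

lemma vdm_succ (n : ℕ) (t : Fin (n + 1) → ℂ) :
    vdm (n + 1) t = (∏ j : Fin n, (t 0 - t j.succ)) * vdm n (fun i => t i.succ) := by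
  simp only [vdm, Fin.prod_univ_succ, Fin.prod_Ioi_zero, Fin.prod_Ioi_succ]

lemma vdm_ne_zero (n : ℕ) (t : Fin n → ℂ) (ht : Function.Injective t) : vdm n t ≠ 0 := by
  rw [vdm, Finset.prod_ne_zero_iff]
  intro i _
  rw [Finset.prod_ne_zero_iff]
  intro j hj h
  have := ht (sub_eq_zero.mp h)
  simp [this] at hj

lemma genA_succ (c : ℂ) (w : ℕ → ℂ → ℂ) (n : ℕ) (t : Fin (n + 1) → ℂ) :
    genA c w (n + 1) t = ∑ p : Fin (n + 1), ((Equiv.Perm.sign (Equiv.swap 0 p) : ℤ) : ℂ) *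
      w 0 (t p) * (∏ j : Fin n, (t p - c * t (Equiv.swap 0 p j.succ))) *
      genA c (fun i => w (i + 1)) n (fun j => t (Equiv.swap 0 p j.succ)) := by
  rw [genA, ← Equiv.sum_comp Equiv.Perm.decomposeFin.symm, Fintype.sum_prod_type]
  refine Finset.sum_congr rfl fun p _ => ?_
  rw [genA, Finset.mul_sum]
  refine Finset.sum_congr rfl fun e _ => ?_
  have h1 : (∏ j : Fin n, (t p - c * t (Equiv.swap 0 p (e j).succ)))
      = ∏ j : Fin n, (t p - c * t (Equiv.swap 0 p j.succ)) :=
    Equiv.prod_comp e (fun j => (t p - c * t (Equiv.swap 0 p j.succ)))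
  have h2 : ((Equiv.Perm.sign (Equiv.swap 0 p) : ℤ) : ℂ) = if p = 0 then 1 else -1 := by
    rw [Equiv.Perm.sign_swap']
    by_cases h : p = 0 <;> simp [h, eq_comm]
  have h3 : ((Equiv.Perm.sign (Equiv.Perm.decomposeFin.symm (p, e)) : ℤ) : ℂ)
      = (if p = 0 then 1 else -1) * ((Equiv.Perm.sign e : ℤ) : ℂ) := by
    rw [Equiv.Perm.decomposeFin.symm_sign]
    by_cases h : p = 0 <;> simp [h]
  simp only [Fin.prod_univ_succ, Fin.prod_Ioi_zero, Fin.prod_Ioi_succ, h2, h3,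
    Equiv.Perm.decomposeFin_symm_apply_zero, Equiv.Perm.decomposeFin_symm_apply_succ, h1,
    Fin.val_zero, Fin.val_succ]
  ring

lemma prod_swap_succ (n : ℕ) (p : Fin (n + 1)) (f : Fin (n + 1) → ℂ) :
    ∏ j : Fin n, f (Equiv.swap 0 p j.succ) = ∏ j ∈ Finset.univ.erase p, f j := by
  have h1 : ∏ j ∈ Finset.univ.erase p, f j = ∏ j, if j = p then 1 else f j := by
    rw [← Finset.mul_prod_erase Finset.univ (fun j => if j = p then 1 else f j)
      (Finset.mem_univ p)]
    simp only [if_true, one_mul]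
    refine Finset.prod_congr rfl fun j hj => ?_
    rw [if_neg (Finset.ne_of_mem_erase hj)]
  rw [h1, ← Equiv.prod_comp (Equiv.swap 0 p), Fin.prod_univ_succ]
  simp only [Equiv.swap_apply_left, if_true, one_mul]
  refine Finset.prod_congr rfl fun j _ => ?_
  rw [if_neg]
  intro h
  have : Equiv.swap 0 p j.succ = Equiv.swap 0 p 0 := by rw [h, Equiv.swap_apply_left]
  exact Fin.succ_ne_zero j ((Equiv.swap 0 p).injective this)

lemma prod_erase_succ (n : ℕ) (k : Fin n) (f : Fin (n + 1) → ℂ) :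
    ∏ j ∈ Finset.univ.erase k.succ, f j = f 0 * ∏ j ∈ Finset.univ.erase k, f j.succ := by
  have : (Finset.univ.erase k.succ : Finset (Fin (n + 1)))
      = insert 0 ((Finset.univ.erase k).map (Fin.succEmb n)) := by
    ext j
    refine Fin.cases ?_ (fun i => ?_) j
    · simp [(Fin.succ_ne_zero k).symm]
    · simp
  rw [this, Finset.prod_insert (by simp), Finset.prod_map]
  simp

lemma lagrange_sum (n : ℕ) (c : ℂ) (t : Fin n → ℂ) (ht : Function.Injective t)
    (h0 : ∀ i, t i ≠ 0) :
    (1 - c) * ∑ k : Fin n, (∏ j ∈ Finset.univ.erase k, (t k - c * t j)) /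
      (∏ j ∈ Finset.univ.erase k, (t k - t j)) = 1 - c ^ n := by
  set P : Polynomial ℂ := ∏ j : Fin n, (Polynomial.X - Polynomial.C (c * t j)) with hP
  have hmon : P.Monic := Polynomial.monic_prod_X_sub_C _ _
  have hdeg : P.natDegree = n := by
    rw [hP, Polynomial.natDegree_finsetProd_X_sub_C_eq_card]; simp
  have hv : Function.Injective (Fin.cons 0 t : Fin (n + 1) → ℂ) := by
    rw [Fin.cons_injective_iff]
    refine ⟨?_, ht⟩
    rintro ⟨i, hi⟩
    exact h0 i hi
  have h := Lagrange.leadingCoeff_eq_sum (s := (Finset.univ : Finset (Fin (n + 1))))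
    (v := (Fin.cons 0 t : Fin (n + 1) → ℂ)) hv.injOn (P := P) (by
      rw [Polynomial.degree_eq_natDegree hmon.ne_zero, hdeg]; simp)
  have he : ∀ x, P.eval x = ∏ j : Fin n, (x - c * t j) := by
    intro x; simp [hP, Polynomial.eval_prod]
  have hz : (Finset.univ.erase (0 : Fin (n + 1))) = Finset.univ.map (Fin.succEmb n) := by
    ext j
    refine Fin.cases ?_ (fun i => ?_) j <;> simp
  rw [hmon.leadingCoeff, Fin.sum_univ_succ, hz, Finset.prod_map] at h
  simp only [prod_erase_succ, he, Fin.cons_zero, Fin.cons_succ, Fin.coe_succEmb, zero_sub,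
    sub_zero] at h
  have e1 : (∏ j : Fin n, -(c * t j)) / (∏ j : Fin n, - t j) = c ^ n := by
    rw [← Finset.prod_div_distrib]
    have : ∀ j : Fin n, -(c * t j) / - t j = c := by
      intro j
      have := h0 j
      field_simp
    simp [this]
  rw [e1] at h
  rw [Finset.mul_sum, eq_sub_iff_add_eq, add_comm]
  refine Eq.trans ?_ h.symm
  congr 1
  refine Finset.sum_congr rfl fun k _ => ?_
  rw [← Finset.mul_prod_erase Finset.univ (fun j => t k - c * t j) (Finset.mem_univ k)]
  have := h0 k
  rw [show t k - c * t k = t k * (1 - c) by ring, mul_assoc, mul_div_mul_left _ _ this, mul_div_assoc]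

/-- Constant weights. -/
lemma genA_const (c : ℂ) (hc : c ≠ 1) (h : ℂ → ℂ) (n : ℕ) (t : Fin n → ℂ)
    (ht : Function.Injective t) (h0 : ∀ i, t i ≠ 0) :
    genA c (fun _ => h) n t
      = (∏ m ∈ Finset.range n, (1 - c ^ (m + 1)) / (1 - c)) * (∏ i, h (t i)) * vdm n t := by
  induction n with
  | zero => simp [genA, vdm]
  | succ n ih =>
    have hc' : 1 - c ≠ 0 := sub_ne_zero.mpr (Ne.symm hc)
    rw [genA_succ]
    have hterm : ∀ p : Fin (n + 1), ((Equiv.Perm.sign (Equiv.swap 0 p) : ℤ) : ℂ) *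
        h (t p) * (∏ j : Fin n, (t p - c * t (Equiv.swap 0 p j.succ))) *
        genA c (fun i => h) n (fun j => t (Equiv.swap 0 p j.succ))
        = (∏ m ∈ Finset.range n, (1 - c ^ (m + 1)) / (1 - c)) * (∏ i, h (t i)) *
          vdm (n + 1) t * ((∏ j ∈ Finset.univ.erase p, (t p - c * t j)) /
      (∏ j ∈ Finset.univ.erase p, (t p - t j))) := by
      intro p
      rw [ih _ (fun i j hij => by simpa using ht hij) (fun i => h0 _)]
      have hv := vdm_perm (n + 1) t (Equiv.swap 0 p)
      rw [vdm_succ] at hv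
      simp only [Equiv.swap_apply_left] at hv
      rw [prod_swap_succ n p (fun x => t p - t x)] at hv
      rw [prod_swap_succ n p (fun x => t p - c * t x), prod_swap_succ n p (fun x => h (t x)),
        ← Finset.mul_prod_erase Finset.univ (fun j => h (t j)) (Finset.mem_univ p)]
      have hne : (∏ j ∈ Finset.univ.erase p, (t p - t j)) ≠ 0 := by
        rw [Finset.prod_ne_zero_iff]
        intro j hj hj'
        exact Finset.ne_of_mem_erase hj (ht (sub_eq_zero.mp hj')).symm
      have hs : ((Equiv.Perm.sign (Equiv.swap 0 p) : ℤ) : ℂ) *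
          ((Equiv.Perm.sign (Equiv.swap 0 p) : ℤ) : ℂ) = 1 := by
        rw [← Int.cast_mul, ← Units.val_mul, Int.units_mul_self]; simp
      generalize ((Equiv.Perm.sign (Equiv.swap 0 p) : ℤ) : ℂ) = ε at hv hs ⊢
      generalize (∏ j ∈ Finset.univ.erase p, (t p - t j)) = X at hv hne ⊢
      have hv' : vdm (n + 1) t = ε * (X * vdm n fun i => t ((Equiv.swap 0 p) i.succ)) := by
        rw [hv, ← mul_assoc, hs, one_mul]
      rw [hv']
      field_simp
    rw [Finset.sum_congr rfl (fun p _ => hterm p), ← Finset.mul_sum, Finset.prod_range_succ]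
    have hl := lagrange_sum (n + 1) c t ht h0
    rw [← hl]
    field_simp

lemma genA_peel (c : ℂ) (w : ℕ → ℂ → ℂ) (n : ℕ) (t : Fin (n + 1) → ℂ)
    (ht : ∀ p : Fin (n + 1), p ≠ 0 → w 0 (t p) = 0 ∨ ∃ j, j ≠ p ∧ t p = c * t j) :
    genA c w (n + 1) t = w 0 (t 0) * (∏ j : Fin n, (t 0 - c * t j.succ)) *
      genA c (fun i => w (i + 1)) n (fun j => t j.succ) := by
  rw [genA_succ, Finset.sum_eq_single 0]
  · simp
  · intro p _ hp
    rcases ht p hp with h | ⟨j, hj, h⟩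
    · simp [h]
    · rw [prod_swap_succ n p (fun x => t p - c * t x),
        Finset.prod_eq_zero (i := j) (by simp [hj]) (by rw [h, sub_self])]
      simp
  · simp

/-- Weight `g` in the first `m` positions and `h` afterwards. -/
noncomputable def wgt (g h : ℂ → ℂ) (m : ℕ) (i : ℕ) (x : ℂ) : ℂ := if i < m then g x else h x

lemma step_aux (c : ℂ) (hc : c ≠ 1) (g h : ℂ → ℂ) (s m : ℕ) : ∀ (n : ℕ) (t : ℕ → ℂ),
    n = m + 1 + s →
    (∀ i j, i < n → j < n → t i = t j → i = j) → (∀ i, i < n → t i ≠ 0) →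
    (∀ i, i + 1 < n → g (t (i + 1)) = 0 ∨ t (i + 1) = c * t i) →
    genA c (wgt g h m) n (fun i : Fin n => t i) *
      (g (t m) * ∏ j ∈ Finset.range s, (t m - c * t (m + 1 + j))) * (1 - c) =
    genA c (wgt g h (m + 1)) n (fun i : Fin n => t i) * (1 - c ^ (s + 1)) *
      (h (t m) * ∏ j ∈ Finset.range s, (t m - t (m + 1 + j))) := by
  have hc' : 1 - c ≠ 0 := sub_ne_zero.mpr (Ne.symm hc)
  have w0 : wgt g h 0 = fun _ => h := by funext i x; simp [wgt]
  have w1 : ∀ m, (fun i => wgt g h (m + 1) (i + 1)) = wgt g h m := by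
    intro m; funext i x; simp [wgt]
  have peel : ∀ m n (t : ℕ → ℂ), 
    (∀ i, i + 1 < n + 1 → g (t (i + 1)) = 0 ∨ t (i + 1) = c * t i) →
     genA c (wgt g h (m + 1)) (n + 1) (fun i : Fin (n + 1) => t i)
      = g (t 0) * (∏ j ∈ Finset.range n, (t 0 - c * t (j + 1))) *
        genA c (wgt g h m) n (fun i : Fin n => t (i + 1)) := by
    intro m n t hch
    rw [genA_peel, w1, Finset.prod_range]
    · simp [wgt]
    · intro p hp
      obtain ⟨i, rfl⟩ := Fin.exists_succ_eq.mpr hp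
      rcases hch i (by omega) with h | h
      · left; simpa [wgt] using h
      · right
        refine ⟨i.castSucc, ?_, by simpa using h⟩
        intro hh
        have := congrArg Fin.val hh
        simp at this
  induction m with
  | zero =>
    intro n t hn hinj h0 hch
    obtain rfl : n = s + 1 := by omega
    rw [peel 0 s t hch, w0, genA_const c hc h (s + 1), genA_const c hc h s, vdm_succ,
      Fin.prod_univ_succ, Finset.prod_range_succ]
    · simp only [Finset.prod_range, Fin.val_succ, Fin.val_zero, zero_add, add_comm 1]
      field_simp
    · intro i j hij
      have := hinj _ _ (by omega) (by omega) hij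
      ext; omega
    · intro i; exact h0 _ (by omega)
    · intro i j hij
      have := hinj _ _ (by omega) (by omega) hij
      ext; omega
    · intro i; exact h0 _ (by omega)
  | succ m ih =>
    intro n t hn hinj h0 hch
    obtain ⟨n, rfl⟩ : ∃ k, n = k + 1 := ⟨n - 1, by omega⟩
    rw [peel _ _ t hch, peel _ _ t hch]
    have := ih n (fun i => t (i + 1)) (by omega)
      (fun i j hi hj hij => by have := hinj _ _ (by omega) (by omega) hij; omega)
      (fun i hi => h0 _ (by omega)) (fun i hi => hch _ (by omega))
    simp only [show ∀ j, m + 1 + j + 1 = m + 1 + 1 + j by intro j; omega] at this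
    linear_combination (g (t 0) * (∏ j ∈ Finset.range n, (t 0 - c * t (j + 1)))) * this

/-- The point `η` as a function on `ℕ`. -/
noncomputable def etaN (n r : ℕ) (x₁ x₂ a b₁ b₂ : ℂ) (i : ℕ) : ℂ :=
  if i < n - r then x₁ * b₁⁻¹ * (a ^ i)⁻¹
  else x₂ * b₂⁻¹ * (a ^ (i - (n - r)))⁻¹

lemma AsumEta_eq (n r s : ℕ) (x₁ x₂ a b₁ b₂ : ℂ) :
    AsumEta n r s x₁ x₂ a b₁ b₂ = genA a⁻¹
      (wgt (fun x => 1 - b₂ * x / x₂) (fun x => 1 - x / x₁) (n - s)) n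
      (fun i : Fin n => etaN n r x₁ x₂ a b₁ b₂ i) := by
  rw [AsumEta, genA]
  refine Finset.sum_congr rfl fun σ _ => ?_
  congr 1
  · congr 1
    rw [phiFun, Finset.prod_filter, Finset.prod_filter, ← Finset.prod_mul_distrib]
    refine Finset.prod_congr rfl fun i _ => ?_
    have he : ∀ j : Fin n, etaPt n r x₁ x₂ a b₁ b₂ j = etaN n r x₁ x₂ a b₁ b₂ j := fun _ => rfl
    simp only [wgt, he]
    by_cases h : (i : ℕ) < n - s
    · rw [if_pos h, if_neg (by omega), if_pos h, mul_one]
    · rw [if_neg h, if_pos (by omega), if_neg h, one_mul]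
  · rw [Finset.prod_filter, Fintype.prod_prod_type]
    refine Finset.prod_congr rfl fun i _ => ?_
    rw [← Finset.prod_filter]
    refine Finset.prod_congr ?_ fun j _ => rfl
    ext j; simp

lemma tele (u v c : ℂ) (r : ℕ) :
    (∏ j ∈ Finset.range r, (u - v * c ^ j)) * (u - v * c ^ r)
      = (∏ j ∈ Finset.range r, (u - c * (v * c ^ j))) * (u - v) := by
  rw [← Finset.prod_range_succ, Finset.prod_range_succ']
  simp only [pow_zero, mul_one]
  congr 1
  refine Finset.prod_congr rfl fun j _ => by ring

lemma eta_step (r d k n : ℕ) (hn : n = k + 1 + (d + r))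
    (x₁ x₂ a b₁ b₂ : ℂ) (hx₁ : x₁ ≠ 0) (hx₂ : x₂ ≠ 0) (ha : a ≠ 0)
    (hb₁ : b₁ ≠ 0) (hb₂ : b₂ ≠ 0)
    (ha1 : ∀ m : ℕ, 1 ≤ m → m ≤ n → a ^ m ≠ 1)
    (hgen : ∀ m : ℤ, |m| ≤ (n : ℤ) → x₂ * b₁ ≠ x₁ * b₂ * a ^ m) :
    AsumEta n r (d + r + 1) x₁ x₂ a b₁ b₂ * (1 - a⁻¹ ^ (d + 1)) *
      (x₂ * b₂⁻¹ * a⁻¹ ^ r - x₁ * b₁⁻¹ * a⁻¹ ^ k) =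
    AsumEta n r (d + r) x₁ x₂ a b₁ b₂ * (1 - a⁻¹ ^ (d + r + 1)) * (x₂ * b₂⁻¹) *
      (1 - b₁⁻¹ * a⁻¹ ^ k) := by
  have hpow : ∀ i j : ℕ, i < j → j ≤ n → a ^ i ≠ a ^ j := by
    intro i j hij hj h
    refine ha1 (j - i) (by omega) (by omega) ?_
    have h2 : a ^ j = a ^ i * a ^ (j - i) := by rw [← pow_add]; congr 1; omega
    rw [h2] at h
    exact (mul_left_cancel₀ (pow_ne_zero i ha) (by rw [← h, mul_one]))
  have hpow' : ∀ i j : ℕ, i ≤ n → j ≤ n → a ^ i = a ^ j → i = j := by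
    intro i j hi hj h
    rcases lt_trichotomy i j with h1 | h1 | h1
    · exact absurd h (hpow i j h1 hj)
    · exact h1
    · exact absurd h.symm (hpow j i h1 hi)
  have hcross : ∀ i j : ℕ, i ≤ n → j ≤ n →
      x₁ * b₁⁻¹ * (a ^ i)⁻¹ ≠ x₂ * b₂⁻¹ * (a ^ j)⁻¹ := by
    intro i j hi hj h
    refine hgen ((j : ℤ) - i) (by rw [abs_le]; constructor <;> omega) ?_
    rw [zpow_sub₀ ha, zpow_natCast, zpow_natCast]
    have := pow_ne_zero i ha
    have := pow_ne_zero j ha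
    field_simp at h ⊢
    linear_combination -h
  have hinj : ∀ i j, i < n → j < n → etaN n r x₁ x₂ a b₁ b₂ i = etaN n r x₁ x₂ a b₁ b₂ j →
      i = j := by
    intro i j hi hj h
    simp only [etaN] at h
    split_ifs at h with h1 h2 h2
    · exact hpow' i j (by omega) (by omega)
        (inv_injective (mul_left_cancel₀ (mul_ne_zero hx₁ (inv_ne_zero hb₁)) h))
    · exact absurd h (hcross _ _ (by omega) (by omega))
    · exact absurd h.symm (hcross _ _ (by omega) (by omega))
    · have := hpow' _ _ (by omega) (by omega)
        (inv_injective (mul_left_cancel₀ (mul_ne_zero hx₂ (inv_ne_zero hb₂)) h))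
      omega
  have hne : ∀ i, i < n → etaN n r x₁ x₂ a b₁ b₂ i ≠ 0 := by
    intro i _
    have := fun i => pow_ne_zero i ha
    simp only [etaN]
    split_ifs <;> simp [*]
  have hch : ∀ i, i + 1 < n → (fun x => 1 - b₂ * x / x₂) (etaN n r x₁ x₂ a b₁ b₂ (i + 1)) = 0 ∨
      etaN n r x₁ x₂ a b₁ b₂ (i + 1) = a⁻¹ * etaN n r x₁ x₂ a b₁ b₂ i := by
    intro i _
    simp only [etaN]
    rcases lt_trichotomy (i + 1) (n - r) with h | h | h
    · right
      rw [if_pos h, if_pos (by omega), pow_succ, mul_inv]; ring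
    · left
      rw [if_neg (by omega), h, Nat.sub_self]
      field_simp
      simp
    · right
      rw [if_neg (by omega), if_neg (by omega),
        show i + 1 - (n - r) = (i - (n - r)) + 1 by omega, pow_succ, mul_inv]; ring
  have hc : a⁻¹ ≠ 1 := by
    intro h
    exact ha1 1 le_rfl (by omega) (by rw [pow_one]; exact inv_eq_one.mp h)
  have hstep := step_aux a⁻¹ hc (fun x => 1 - b₂ * x / x₂) (fun x => 1 - x / x₁) (d + r) k n
    (etaN n r x₁ x₂ a b₁ b₂) hn hinj hne hch
  have hP : ∏ j ∈ Finset.range (d + r), (etaN n r x₁ x₂ a b₁ b₂ k -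
      etaN n r x₁ x₂ a b₁ b₂ (k + 1 + j)) ≠ 0 := by
    rw [Finset.prod_ne_zero_iff]
    intro j hj h
    rw [Finset.mem_range] at hj
    have := hinj _ _ (by omega) (by omega) (sub_eq_zero.mp h)
    omega
  rw [AsumEta_eq, AsumEta_eq, show n - (d + r + 1) = k by omega,
    show n - (d + r) = k + 1 by omega]
  generalize genA a⁻¹ (wgt _ _ k) n _ = F1 at hstep ⊢
  generalize genA a⁻¹ (wgt _ _ (k + 1)) n _ = F0 at hstep ⊢
  have hk : etaN n r x₁ x₂ a b₁ b₂ k = x₁ * b₁⁻¹ * a⁻¹ ^ k := by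
    rw [etaN, if_pos (by omega), inv_pow]
  have hA : ∀ j ∈ Finset.range d, etaN n r x₁ x₂ a b₁ b₂ (k + 1 + j)
      = etaN n r x₁ x₂ a b₁ b₂ k * a⁻¹ * a⁻¹ ^ j := by
    intro j hj
    rw [Finset.mem_range] at hj
    rw [hk, etaN, if_pos (by omega), ← inv_pow]; ring
  have hB : ∀ j ∈ Finset.range r, etaN n r x₁ x₂ a b₁ b₂ (k + 1 + (d + j))
      = x₂ * b₂⁻¹ * a⁻¹ ^ j := by
    intro j hj
    rw [etaN, if_neg (by omega), ← inv_pow, show k + 1 + (d + j) - (n - r) = j by omega]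
  rw [Finset.prod_range_add] at hP
  rw [Finset.prod_range_add, Finset.prod_range_add] at hstep
  rw [Finset.prod_congr rfl (fun j hj => by rw [hA j hj]),
    Finset.prod_congr (s₁ := Finset.range r) rfl (fun j hj => by rw [hB j hj])] at hP
  rw [Finset.prod_congr (s₁ := Finset.range d) (f := fun j => etaN n r x₁ x₂ a b₁ b₂ k -
      a⁻¹ * etaN n r x₁ x₂ a b₁ b₂ (k + 1 + j)) rfl (fun j hj => by rw [hA j hj]),
    Finset.prod_congr (s₁ := Finset.range r) (f := fun j => etaN n r x₁ x₂ a b₁ b₂ k -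
      a⁻¹ * etaN n r x₁ x₂ a b₁ b₂ (k + 1 + (d + j))) rfl (fun j hj => by rw [hB j hj]),
    Finset.prod_congr (s₁ := Finset.range d) (f := fun j => etaN n r x₁ x₂ a b₁ b₂ k -
      etaN n r x₁ x₂ a b₁ b₂ (k + 1 + j)) rfl (fun j hj => by rw [hA j hj]),
    Finset.prod_congr (s₁ := Finset.range r) (f := fun j => etaN n r x₁ x₂ a b₁ b₂ k -
      etaN n r x₁ x₂ a b₁ b₂ (k + 1 + (d + j))) rfl (fun j hj => by rw [hB j hj])] at hstep
  have hu0 := hne k (by omega)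
  have hh : (1 - b₁⁻¹ * a⁻¹ ^ k) = 1 - etaN n r x₁ x₂ a b₁ b₂ k / x₁ := by
    rw [hk]; field_simp
  rw [hh, ← hk]
  generalize etaN n r x₁ x₂ a b₁ b₂ k = u at *
  have t1 := tele u (u * a⁻¹) a⁻¹ d
  have t2 := tele u (x₂ * b₂⁻¹) a⁻¹ r
  have hg : (1 - b₂ * u / x₂) * (x₂ * b₂⁻¹) = - (u - x₂ * b₂⁻¹) := by
    field_simp; ring
  have hv : x₂ * b₂⁻¹ ≠ 0 := mul_ne_zero hx₂ (inv_ne_zero hb₂)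
  generalize (1 - b₂ * u / x₂) = G at *
  generalize x₂ * b₂⁻¹ = v at *
  generalize (1 - u / x₁) = H at *
  generalize a⁻¹ = c at *
  generalize (∏ j ∈ Finset.range d, (u - u * c * c ^ j)) = P1 at *
  generalize (∏ j ∈ Finset.range r, (u - v * c ^ j)) = P2 at *
  generalize (∏ j ∈ Finset.range d, (u - c * (u * c * c ^ j))) = Q1 at *
  generalize (∏ j ∈ Finset.range r, (u - c * (v * c ^ j))) = Q2 at *
  apply mul_left_cancel₀ (mul_ne_zero hP hu0)
  linear_combination (u * v) * hstep - (F1 * Q1 * Q2 * (1 - c) * u) * hg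
    - F1 * (u - v * c ^ r) * P2 * t1 - F1 * Q1 * (u - u * c) * t2

/-- The off-diagonal/diagonal ratio `c⁻_{A,rs}/c⁻_{A,rr}` of Proposition 3.2:
`𝒜(φ_s·D_a)(η) = ((x₂/x₁)b₂⁻¹a^{−r})^{s−r} · (b₁a^{n−s};a)_{s−r}/((x₂/x₁)b₁b₂⁻¹a^{n−s−r};a)_{s−r}
  · (a;a)_s/((a;a)_r(a;a)_{s−r}) · 𝒜(φ_r·D_a)(η)`. -/
theorem prop3_2_ratio (n r s : ℕ) (hn : 1 ≤ n) (hrs : r ≤ s) (hs : s ≤ n)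
    (x₁ x₂ a b₁ b₂ : ℂ) (hx₁ : x₁ ≠ 0) (hx₂ : x₂ ≠ 0) (ha : a ≠ 0)
    (hb₁ : b₁ ≠ 0) (hb₂ : b₂ ≠ 0)
    (ha1 : ∀ m : ℕ, 1 ≤ m → m ≤ n → a ^ m ≠ 1)
    (hb₁a : ∀ m : ℕ, m ≤ n → b₁ * a ^ m ≠ 1)
    (hgen : ∀ m : ℤ, |m| ≤ (n : ℤ) → x₂ * b₁ ≠ x₁ * b₂ * a ^ m)
    (hgen' : ∀ m : ℤ, |m| ≤ (n : ℤ) → x₂ ≠ x₁ * b₂ * a ^ m) :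
    AsumEta n r s x₁ x₂ a b₁ b₂
    = (x₂ / x₁ * b₂⁻¹ * a ^ (-(r : ℤ))) ^ (s - r) *
        (qPoch (b₁ * a ^ (n - s)) a (s - r) /
          qPoch (x₂ / x₁ * b₁ * b₂⁻¹ * a ^ ((n : ℤ) - (s : ℤ) - (r : ℤ))) a (s - r)) *
        (qPoch a a s / (qPoch a a r * qPoch a a (s - r))) *
        AsumEta n r r x₁ x₂ a b₁ b₂ := by
  obtain ⟨d, rfl⟩ : ∃ d, s = d + r := ⟨s - r, by omega⟩
  clear hrs
  rw [Nat.add_sub_cancel]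
  have hq0 : ∀ m, m ≤ n → qPoch a a m ≠ 0 := by
    intro m hm
    rw [qPoch, Finset.prod_ne_zero_iff]
    intro i hi h
    rw [Finset.mem_range] at hi
    exact ha1 (i + 1) (by omega) (by omega) (by rw [pow_succ]; linear_combination -h)
  induction d with
  | zero =>
    have := hq0 r (by omega)
    simp [qPoch]
    rw [div_self (by simpa [qPoch] using this), one_mul]
  | succ d ih =>
    specialize ih (by omega)
    obtain ⟨k, hk⟩ : ∃ k, n = k + 1 + (d + r) := ⟨n - (d + r + 1), by omega⟩
    have hst := eta_step r d k n hk x₁ x₂ a b₁ b₂ hx₁ hx₂ ha hb₁ hb₂ ha1 hgen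
    have e1 : d + 1 + r = d + r + 1 := by omega
    rw [e1, show n - (d + r + 1) = k by omega]
    rw [show n - (d + r) = k + 1 by omega] at ih
    rw [show (n : ℤ) - ((d + r + 1 : ℕ) : ℤ) - (r : ℤ) = (k : ℤ) - r by rw [hk]; push_cast; ring]
    rw [show (n : ℤ) - ((d + r : ℕ) : ℤ) - (r : ℤ) = ((k : ℤ) - r) + 1 by
      rw [hk]; push_cast; ring] at ih
    have qs : ∀ x m, qPoch x a (m + 1) = (1 - x) * qPoch (x * a) a m := by
      intro x m
      rw [qPoch, qPoch, Finset.prod_range_succ', mul_comm]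
      simp only [pow_zero, one_mul]
      congr 1
      refine Finset.prod_congr rfl fun i _ => by ring
    have qe : ∀ m, qPoch a a (m + 1) = qPoch a a m * (1 - a ^ (m + 1)) := by
      intro m
      rw [qPoch, qPoch, Finset.prod_range_succ, pow_succ]
    rw [qs, qs, qe, qe, pow_succ]
    rw [zpow_add_one₀ ha, ← mul_assoc (_ * _) (a ^ ((k : ℤ) - r)) a, pow_succ, ← mul_assoc b₁] at ih
    have hy : 1 - x₂ / x₁ * b₁ * b₂⁻¹ * a ^ ((k : ℤ) - r) ≠ 0 := by
      intro h
      refine hgen ((r : ℤ) - k) (by rw [abs_le]; constructor <;> omega) ?_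
      rw [zpow_sub₀ ha, zpow_natCast, zpow_natCast] at h ⊢
      have := pow_ne_zero k ha
      have := pow_ne_zero r ha
      field_simp at h ⊢
      linear_combination -h
    have hd : 1 - a ^ (d + 1) ≠ 0 := fun h =>
      ha1 (d + 1) (by omega) (by omega) (by linear_combination -h)
    have hkey : AsumEta n r (d + r + 1) x₁ x₂ a b₁ b₂ = AsumEta n r (d + r) x₁ x₂ a b₁ b₂ *
        ((x₂ / x₁ * b₂⁻¹ * a ^ (-(r : ℤ))) * (1 - b₁ * a ^ k) *
        (1 - x₂ / x₁ * b₁ * b₂⁻¹ * a ^ ((k : ℤ) - r))⁻¹ * (1 - a ^ (d + r + 1)) *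
          (1 - a ^ (d + 1))⁻¹) := by
      rw [← div_eq_mul_inv, ← div_eq_mul_inv]
      rw [zpow_sub₀ ha, zpow_natCast, zpow_natCast] at hy ⊢
      rw [zpow_neg, zpow_natCast]
      have h1 := pow_ne_zero k ha
      have h2 := pow_ne_zero r ha
      have h3 := pow_ne_zero d ha
      generalize AsumEta n r (d + r + 1) x₁ x₂ a b₁ b₂ = F1 at *
      generalize AsumEta n r (d + r) x₁ x₂ a b₁ b₂ = F0 at *
      simp only [inv_pow, pow_add, pow_one] at hst hd ⊢
      generalize a ^ k = A at *
      generalize a ^ r = B at *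
      generalize a ^ d = E at *
      have hy' : x₁ * B * b₂ - x₂ * b₁ * A ≠ 0 := by
        intro h; apply hy; field_simp; linear_combination h
      rw [show (1 - x₂ / x₁ * b₁ * b₂⁻¹ * (A / B)) =
        (x₁ * B * b₂ - x₂ * b₁ * A) / (x₁ * B * b₂) by field_simp]
      field_simp at hst ⊢
      rw [eq_div_iff (by intro h; apply hy'; linear_combination h)]
      linear_combination hst
    rw [hkey, ih]
    simp only [div_eq_mul_inv, mul_inv]
    ring
end

section
/- Fix n ≥ 1 and nonzero complex numbers A, b₁, c (playing the roles of q^{α̃}, q^{β₁}, q^{γ}) with c^m ≠ 1 for 1 ≤ m ≤ n and A b₁ c^m ≠ 1 for all integers −2n+1 ≤ m ≤ 0. Define (n+1)×(n+1) upper triangular matrices U = (u_{rs})_{r,s=0}^n and U* = (u*_{rs})_{r,s=0}^n by u_{rs} = u*_{rs} = 0 for r > s and, for r ≤ s, u_{rs} = (−1)^{s−r} A^{s−r} c^{−(n−1)(s−r)−(s−r)(s+r−1)/2} · [(c;c)_s / ((c;c)_{s−r}·(c;c)_r)] · [(b₁ c^{n−s};c)_{s−r} / (A b₁ c^{−2(s−1)};c)_{s−r}],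 and u*_{rs} = A^{s−r} c^{−(n−1)(s−r)+r(r−s)} · [(c;c)_s / ((c;c)_{s−r}·(c;c)_r)] · [(b₁ c^{n−s};c)_{s−r} / (A b₁ c^{−(r+s−1)};c)_{s−r}]. Then U·U* = I_{n+1}, i.e. U* = U^{−1}. (Theorem 5.4: the matrices U_A and U_A^{−1} in the Gauss decomposition of A(q^{α̃}) are mutually inverse.) -/
open Finset

/-- The upper triangular matrix `U = U_A` of Theorem 5.4:
for `r ≤ s`, `u_{rs} = (−1)^{s−r} A^{s−r} c^{−(n−1)(s−r)−(s−r)(s+r−1)/2}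
· (c;c)_s/((c;c)_{s−r}(c;c)_r) · (b₁c^{n−s};c)_{s−r}/(Ab₁c^{−2(s−1)};c)_{s−r}`. -/
noncomputable def Umat (n : ℕ) (A b₁ c : ℂ) : Matrix (Fin (n + 1)) (Fin (n + 1)) ℂ :=
  fun r s =>
    if (r : ℕ) ≤ (s : ℕ) then
      (-1 : ℂ) ^ ((s : ℕ) - (r : ℕ)) * A ^ ((s : ℕ) - (r : ℕ)) *
        c ^ (-(((n - 1) * ((s : ℕ) - (r : ℕ)) +
              ((s : ℕ) - (r : ℕ)) * ((s : ℕ) + (r : ℕ) - 1) / 2 : ℕ) : ℤ)) *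
        (qPoch c c (s : ℕ) / (qPoch c c ((s : ℕ) - (r : ℕ)) * qPoch c c (r : ℕ))) *
        (qPoch (b₁ * c ^ (n - (s : ℕ))) c ((s : ℕ) - (r : ℕ)) /
          qPoch (A * b₁ * c ^ ((2 : ℤ) - 2 * (s : ℤ))) c ((s : ℕ) - (r : ℕ)))
    else 0

/-- The upper triangular matrix `U* = U_A⁻¹` of Theorem 5.4:
for `r ≤ s`, `u*_{rs} = A^{s−r} c^{−(n−1)(s−r)+r(r−s)}
· (c;c)_s/((c;c)_{s−r}(c;c)_r) · (b₁c^{n−s};c)_{s−r}/(Ab₁c^{−(r+s−1)};c)_{s−r}`. -/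
noncomputable def UstarMat (n : ℕ) (A b₁ c : ℂ) : Matrix (Fin (n + 1)) (Fin (n + 1)) ℂ :=
  fun r s =>
    if (r : ℕ) ≤ (s : ℕ) then
      A ^ ((s : ℕ) - (r : ℕ)) *
        c ^ (-(((n - 1) * ((s : ℕ) - (r : ℕ)) +
              (r : ℕ) * ((s : ℕ) - (r : ℕ)) : ℕ) : ℤ)) *
        (qPoch c c (s : ℕ) / (qPoch c c ((s : ℕ) - (r : ℕ)) * qPoch c c (r : ℕ))) *
        (qPoch (b₁ * c ^ (n - (s : ℕ))) c ((s : ℕ) - (r : ℕ)) /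
          qPoch (A * b₁ * c ^ ((1 : ℤ) - (r : ℤ) - (s : ℤ))) c ((s : ℕ) - (r : ℕ)))
    else 0

theorem qPoch_add (x c : ℂ) (a b : ℕ) :
    qPoch x c (a + b) = qPoch x c a * qPoch (x * c ^ a) c b := by
  unfold qPoch
  rw [Finset.prod_range_add]
  congr 1
  apply Finset.prod_congr rfl
  intro i _
  ring

theorem qPoch_zero (x c : ℂ) : qPoch x c 0 = 1 := by simp [qPoch]

theorem qPoch_one (x c : ℂ) : qPoch x c 1 = 1 - x := by simp [qPoch]

theorem qPoch_succ (x c : ℂ) (m : ℕ) : qPoch x c (m + 1) = qPoch x c m * (1 - x * c ^ m) := by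
  rw [qPoch_add, qPoch_one]

theorem qPoch_succ' (x c : ℂ) (m : ℕ) : qPoch x c (m + 1) = (1 - x) * qPoch (x * c) c m := by
  rw [add_comm, qPoch_add, qPoch_one, pow_one]

theorem qPoch_ne (x c : ℂ) (m : ℕ) (h : ∀ i < m, x * c ^ i ≠ 1) : qPoch x c m ≠ 0 := by
  unfold qPoch
  rw [Finset.prod_ne_zero_iff]
  intro i hi h0
  apply h i (Finset.mem_range.1 hi)
  linear_combination -h0

theorem qPoch_cc_ne (c : ℂ) (n m : ℕ) (hc1 : ∀ m : ℕ, 1 ≤ m → m ≤ n → c ^ m ≠ 1) (hm : m ≤ n) :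
    qPoch c c m ≠ 0 := by
  apply qPoch_ne
  intro i hi
  rw [← pow_succ']
  exact hc1 _ (by omega) (by omega)

theorem qPoch_z_ne (y c : ℂ) (hc : c ≠ 0) (lo : ℤ) (hy : ∀ m : ℤ, lo ≤ m → m ≤ 0 → y * c ^ m ≠ 1)
    (a : ℤ) (m : ℕ) (h1 : lo ≤ a) (h2 : a + m ≤ 1) : qPoch (y * c ^ a) c m ≠ 0 := by
  apply qPoch_ne
  intro i hi
  have : y * c ^ a * c ^ i = y * c ^ (a + i) := by
    rw [zpow_add₀ hc, zpow_natCast]; ring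
  rw [this]
  exact hy _ (by omega) (by omega)

/-- The exponent. -/
def ee (N k : ℕ) : ℤ := ((k * (k + 1) / 2 : ℕ) : ℤ) - k * N

theorem ee_succ (N k : ℕ) : ee N (k + 1) = ee N k + (k + 1) - N := by
  unfold ee
  have : (k + 1) * (k + 1 + 1) / 2 = k * (k + 1) / 2 + (k + 1) := by
    rw [show (k + 1) * (k + 1 + 1) = k * (k + 1) + 2 * (k + 1) by ring]
    omega
  rw [this]; push_cast; ring

/-- The summand. -/
noncomputable def tt (y c : ℂ) (N k : ℕ) : ℂ :=
  (-1) ^ k * c ^ ee N k / (qPoch c c k * qPoch c c (N - k) *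
    (qPoch (y * c ^ (2 - 2 * k : ℤ)) c k * qPoch (y * c ^ (1 - k - N : ℤ)) c (N - k)))

theorem partial_sum (y c : ℂ) (M : ℕ) (hc : c ≠ 0)
    (hc1 : ∀ m : ℕ, 1 ≤ m → m ≤ M + 1 → c ^ m ≠ 1)
    (hy : ∀ m : ℤ, 1 - 2 * ((M + 1 : ℕ) : ℤ) ≤ m → m ≤ 0 → y * c ^ m ≠ 1) (K : ℕ) (hK : K ≤ M) :
    ∑ k ∈ Finset.range (K + 1), tt y c (M + 1) k =
      (-1) ^ K * c ^ ee (M + 1) K / ((1 - c ^ (M + 1)) * qPoch c c K * qPoch c c (M - K) *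
        qPoch (y * c ^ (1 - K - (M + 1 : ℕ) : ℤ)) c (M + 1)) := by
  induction K with
  | zero =>
    simp only [zero_add, Finset.sum_range_one, tt, qPoch_zero, Nat.sub_zero]
    rw [qPoch_succ c c M, ← pow_succ']
    congr 1
    ring
  | succ K ih =>
    rw [Finset.sum_range_succ, ih (by omega)]
    obtain ⟨L, rfl⟩ : ∃ L, M = K + 1 + L := ⟨M - (K + 1), by omega⟩
    unfold tt
    rw [ee_succ]
    rw [show K + 1 + L + 1 - (K + 1) = L + 1 by omega, show K + 1 + L - K = L + 1 by omega,
      show K + 1 + L - (K + 1) = L by omega]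
    obtain ⟨z, hz⟩ : ∃ z, z = y * c ^ (-2 * K - L - 2 : ℤ) := ⟨_, rfl⟩
    have hzz : ∀ i : ℕ, z * c ^ i = y * c ^ (-2 * K - L - 2 + i : ℤ) := by
      intro i
      rw [hz, zpow_add₀ hc _ (i : ℤ), zpow_natCast]; ring
    have e1 : y * c ^ (1 - (K + 1 : ℕ) - (K + 1 + L + 1 : ℕ) : ℤ) = z := by
      rw [hz]; congr 2; push_cast; ring
    have e2 : y * c ^ (1 - K - (K + 1 + L + 1 : ℕ) : ℤ) = z * c := by
      have := hzz 1
      rw [pow_one] at this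
      rw [this]; congr 2; push_cast; ring
    have e3 : y * c ^ (2 - 2 * (K + 1 : ℕ) : ℤ) = z * c ^ (L + 2) := by
      rw [hzz]; congr 2; push_cast; ring
    rw [e1, e2, e3]
    have hne : ∀ i : ℕ, i ≤ K + L + 2 → 1 - z * c ^ i ≠ 0 := by
      intro i hi h
      rw [hzz] at h
      exact hy (-2 * K - L - 2 + i) (by push_cast; omega) (by omega) (by linear_combination -h)
    have hP : qPoch (z * c) c L ≠ 0 := by
      apply qPoch_ne
      intro i hi h
      exact hne (i + 1) (by omega) (by rw [pow_succ]; linear_combination -h)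
    have hQ : qPoch (z * c ^ (L + 2)) c K ≠ 0 := by
      apply qPoch_ne
      intro i hi h
      exact hne (i + L + 2) (by omega) (by linear_combination -h)
    have d1 : qPoch (z * c ^ (L + 2)) c (K + 1) =
        qPoch (z * c ^ (L + 2)) c K * (1 - z * c ^ (K + L + 2)) := by
      rw [qPoch_succ]; ring
    have d2 : qPoch z c (L + 1) = (1 - z) * qPoch (z * c) c L := qPoch_succ' _ _ _
    have d3 : qPoch z c (K + 1 + L + 1) = (1 - z) * qPoch (z * c) c L *
        ((1 - z * c ^ (L + 1)) * qPoch (z * c ^ (L + 2)) c K) := by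
      rw [show K + 1 + L + 1 = (L + 1) + (K + 1) by ring, qPoch_add, d2, qPoch_succ']
      rw [mul_assoc z, ← pow_succ]
    have d4 : qPoch (z * c) c (K + 1 + L + 1) = qPoch (z * c) c L *
        ((1 - z * c ^ (L + 1)) * (qPoch (z * c ^ (L + 2)) c K * (1 - z * c ^ (K + L + 2)))) := by
      rw [show K + 1 + L + 1 = L + ((K + 1) + 1) by ring, qPoch_add, qPoch_succ', ← d1]
      rw [show z * c * c ^ L * c = z * c ^ (L + 2) by ring,
        show z * c * c ^ L = z * c ^ (L + 1) by ring]
    rw [d1, d2, d3, d4, qPoch_succ c c L, qPoch_succ c c K, ← pow_succ', ← pow_succ']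
    have hcK := qPoch_cc_ne c _ K hc1 (by omega)
    have hcL := qPoch_cc_ne c _ L hc1 (by omega)
    have h0 := hne 0 (by omega)
    rw [pow_zero, mul_one] at h0
    have h1 := hne (L + 1) (by omega)
    have h2 := hne (K + L + 2) (by omega)
    have k1 : 1 - c ^ (L + 1) ≠ 0 := fun h => hc1 (L + 1) (by omega) (by omega) (by linear_combination -h)
    have k2 : 1 - c ^ (K + 1) ≠ 0 := fun h => hc1 (K + 1) (by omega) (by omega) (by linear_combination -h)
    have k3 : 1 - c ^ (K + 1 + L + 1) ≠ 0 := fun h =>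
      hc1 (K + 1 + L + 1) (by omega) (by omega) (by linear_combination -h)
    have hw : c ^ ee (K + 1 + L + 1) K =
        c ^ (ee (K + 1 + L + 1) K + (K + 1) - (K + 1 + L + 1 : ℕ)) * c ^ (L + 1) := by
      rw [← zpow_natCast c (L + 1), ← zpow_add₀ hc]
      congr 1; push_cast; ring
    rw [hw]
    generalize c ^ (ee (K + 1 + L + 1) K + (K + 1) - (K + 1 + L + 1 : ℕ)) = w
    generalize qPoch (z * c) c L = P at *
    generalize qPoch (z * c ^ (L + 2)) c K = Q at *
    generalize qPoch c c L = CL at *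
    generalize qPoch c c K = CK at *
    have p1 : c ^ (K + 1 + L + 1) = c ^ (L + 1) * c ^ (K + 1) := by ring
    have p2 : c ^ (K + L + 2) = c ^ (L + 1) * c ^ (K + 1) := by ring
    rw [p1] at k3
    rw [p2] at h2
    rw [p1, p2, pow_succ (-1 : ℂ) K]
    generalize c ^ (L + 1) = u at *
    generalize c ^ (K + 1) = v at *
    clear * - hcK hcL h0 h1 h2 k1 k2 k3 hP hQ
    have h1a : 1 - u * z ≠ 0 := by rwa [mul_comm]
    have h2a : 1 - u * v * z ≠ 0 := by rwa [mul_comm]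
    have h2b : 1 - z * u * v ≠ 0 := by rwa [mul_assoc]
    have h2c : 1 - u * z * v ≠ 0 := by rwa [mul_comm u z]
    have h2d : 1 - u * (z * v) ≠ 0 := by rwa [← mul_assoc]
    field_simp
    ring

theorem full_sum (y c : ℂ) (M : ℕ) (hc : c ≠ 0)
    (hc1 : ∀ m : ℕ, 1 ≤ m → m ≤ M + 1 → c ^ m ≠ 1)
    (hy : ∀ m : ℤ, 1 - 2 * ((M + 1 : ℕ) : ℤ) ≤ m → m ≤ 0 → y * c ^ m ≠ 1) :
    ∑ k ∈ Finset.range (M + 1 + 1), tt y c (M + 1) k = 0 := by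
  rw [Finset.sum_range_succ, partial_sum y c M hc hc1 hy M le_rfl]
  unfold tt
  rw [ee_succ, Nat.sub_self, Nat.sub_self, qPoch_zero, qPoch_zero, qPoch_succ c c M, ← pow_succ',
    show (1 - (M : ℤ) - (M + 1 : ℕ)) = 2 - 2 * (M + 1 : ℕ) by push_cast; ring,
    show ee (M + 1) M + (M + 1) - (M + 1 : ℕ) = ee (M + 1) M by push_cast; ring, pow_succ]
  ring

theorem entry (n : ℕ) (A b₁ c : ℂ) (hA : A ≠ 0) (hc : c ≠ 0)
    (hc1 : ∀ m : ℕ, 1 ≤ m → m ≤ n → c ^ m ≠ 1)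
    (r k N : ℕ) (hk : k ≤ N) (hN : r + N ≤ n) :
    ((-1 : ℂ) ^ k * A ^ k *
        c ^ (-(((n - 1) * k + k * (r + k + r - 1) / 2 : ℕ) : ℤ)) *
        (qPoch c c (r + k) / (qPoch c c k * qPoch c c r)) *
        (qPoch (b₁ * c ^ (n - (r + k))) c k /
          qPoch (A * b₁ * c ^ ((2 : ℤ) - 2 * ((r + k : ℕ) : ℤ))) c k)) *
     (A ^ (N - k) *
        c ^ (-(((n - 1) * (N - k) + (r + k) * (N - k) : ℕ) : ℤ)) *
        (qPoch c c (r + N) / (qPoch c c (N - k) * qPoch c c (r + k))) *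
        (qPoch (b₁ * c ^ (n - (r + N))) c (N - k) /
          qPoch (A * b₁ * c ^ ((1 : ℤ) - ((r + k : ℕ) : ℤ) - ((r + N : ℕ) : ℤ))) c (N - k))) =
    A ^ N * c ^ (-(((n - 1) * N + r * N : ℕ) : ℤ)) * (qPoch c c (r + N) / qPoch c c r) *
      qPoch (b₁ * c ^ (n - (r + N))) c N * tt (A * b₁ * c ^ (-2 * r : ℤ)) c N k := by
  obtain ⟨L, rfl⟩ : ∃ L, N = k + L := ⟨N - k, by omega⟩
  unfold tt
  rw [show k + L - k = L by omega]
  have hq := qPoch_cc_ne c n (r + k) hc1 (by omega)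
  have e1 : A * b₁ * c ^ (-2 * r : ℤ) * c ^ (2 - 2 * k : ℤ) =
      A * b₁ * c ^ ((2 : ℤ) - 2 * ((r + k : ℕ) : ℤ)) := by
    rw [mul_assoc _ (c ^ _), ← zpow_add₀ hc]; congr 2; push_cast; ring
  have e2 : A * b₁ * c ^ (-2 * r : ℤ) * c ^ (1 - k - (k + L : ℕ) : ℤ) =
      A * b₁ * c ^ ((1 : ℤ) - ((r + k : ℕ) : ℤ) - ((r + (k + L) : ℕ) : ℤ)) := by
    rw [mul_assoc _ (c ^ _), ← zpow_add₀ hc]; congr 2; push_cast; ring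
  rw [e1, e2]
  have e3 : qPoch (b₁ * c ^ (n - (r + (k + L)))) c (k + L) =
      qPoch (b₁ * c ^ (n - (r + (k + L)))) c L * qPoch (b₁ * c ^ (n - (r + k))) c k := by
    rw [add_comm k L, qPoch_add, mul_assoc b₁, ← pow_add]
    congr 4; omega
  rw [e3]
  have hdiv : ((k * (r + k + r - 1) / 2 : ℕ) : ℤ) + ((k * (k + 1) / 2 : ℕ) : ℤ) = k * r + k * k := by
    have h1 : k * (r + k + r - 1) / 2 + k * (k + 1) / 2 = k * r + k * k := by
      have hev : Even (k * (k + 1)) := Nat.even_mul_succ_self k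
      obtain ⟨t, ht⟩ := hev
      have : k * (r + k + r - 1) + k * (k + 1) = 2 * (k * r + k * k) := by
        rcases k with _ | k
        · simp
        · rw [show r + (k + 1) + r - 1 = r + k + r by omega]; ring
      omega
    exact_mod_cast h1
  have hpow : c ^ (-(((n - 1) * k + k * (r + k + r - 1) / 2 : ℕ) : ℤ)) *
      c ^ (-(((n - 1) * L + (r + k) * L : ℕ) : ℤ)) =
      c ^ (-(((n - 1) * (k + L) + r * (k + L) : ℕ) : ℤ)) * c ^ ee (k + L) k := by
    rw [← zpow_add₀ hc, ← zpow_add₀ hc]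
    congr 1
    unfold ee
    rw [Nat.cast_add ((n - 1) * k)]
    generalize ((k * (r + k + r - 1) / 2 : ℕ) : ℤ) = a at *
    generalize ((k * (k + 1) / 2 : ℕ) : ℤ) = b at *
    push_cast
    linear_combination -hdiv
  rw [pow_add A]
  calc _ = (c ^ (-(((n - 1) * k + k * (r + k + r - 1) / 2 : ℕ) : ℤ)) *
      c ^ (-(((n - 1) * L + (r + k) * L : ℕ) : ℤ))) * ((-1) ^ k * A ^ k * A ^ L *
      (qPoch c c (r + k) / qPoch c c (r + k)) * (qPoch c c (r + (k + L)) / (qPoch c c k * qPoch c c r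
        * qPoch c c L)) * (qPoch (b₁ * c ^ (n - (r + k))) c k /
          qPoch (A * b₁ * c ^ ((2 : ℤ) - 2 * ((r + k : ℕ) : ℤ))) c k) *
          (qPoch (b₁ * c ^ (n - (r + (k + L)))) c L /
          qPoch (A * b₁ * c ^ ((1 : ℤ) - ((r + k : ℕ) : ℤ) - ((r + (k + L) : ℕ) : ℤ))) c L)) := by
        ring
    _ = _ := by
        rw [hpow, div_self hq]
        ring

theorem thm5_4_inverse (n : ℕ) (hn : 1 ≤ n) (A b₁ c : ℂ)
    (hA : A ≠ 0) (hb₁ : b₁ ≠ 0) (hc : c ≠ 0)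
    (hc1 : ∀ m : ℕ, 1 ≤ m → m ≤ n → c ^ m ≠ 1)
    (hAb : ∀ m : ℤ, -2 * (n : ℤ) + 1 ≤ m → m ≤ 0 → A * b₁ * c ^ m ≠ 1) :
    Umat n A b₁ c * UstarMat n A b₁ c = 1 := by
  ext ⟨r, hr⟩ ⟨s, hs⟩
  rw [Matrix.mul_apply, Matrix.one_apply]
  by_cases hrs : r ≤ s
  · obtain ⟨N, rfl⟩ : ∃ N, s = r + N := ⟨s - r, by omega⟩
    have key : ∑ j : Fin (n + 1), Umat n A b₁ c ⟨r, hr⟩ j * UstarMat n A b₁ c j ⟨r + N, hs⟩ =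
        ∑ k ∈ Finset.range (N + 1), A ^ N * c ^ (-(((n - 1) * N + r * N : ℕ) : ℤ)) *
          (qPoch c c (r + N) / qPoch c c r) *
          qPoch (b₁ * c ^ (n - (r + N))) c N * tt (A * b₁ * c ^ (-2 * r : ℤ)) c N k := by
      symm
      apply Finset.sum_bij_ne_zero (fun k hk _ => (⟨r + k, by
        have := Finset.mem_range.1 hk; omega⟩ : Fin (n + 1)))
      · intros; exact Finset.mem_univ _
      · intro a _ _ b _ _ h
        simpa using h
      · rintro ⟨j, hj⟩ _ hne
        have h1 : r ≤ j := by
          by_contra h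
          exact hne (by simp [Umat, h])
        have h2 : j ≤ r + N := by
          by_contra h
          exact hne (by simp [UstarMat, h])
        obtain ⟨k, rfl⟩ : ∃ k, j = r + k := ⟨j - r, by omega⟩
        refine ⟨k, Finset.mem_range.2 (by omega), ?_, rfl⟩
        rw [← entry n A b₁ c hA hc hc1 r k N (by omega) (by omega)]
        convert hne using 1
        simp only [Umat, UstarMat]
        rw [if_pos h1, if_pos h2, show r + k - r = k by omega, show r + N - (r + k) = N - k by omega,
          ]
      · intro k hk _
        have hk' := Finset.mem_range.1 hk
        rw [← entry n A b₁ c hA hc hc1 r k N (by omega) (by omega)]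
        simp only [Umat, UstarMat]
        rw [if_pos (by omega), if_pos (by omega), show r + k - r = k by omega,
          show r + N - (r + k) = N - k by omega]
    rw [key, ← Finset.mul_sum]
    rcases N with _ | M
    · simp [tt, qPoch_zero, ee, div_self (qPoch_cc_ne c n r hc1 (by omega))]
    · rw [full_sum _ _ _ hc (fun m h1 h2 => hc1 m h1 (by omega)), mul_zero, if_neg]
      · simp
      · intro m h1 h2
        rw [mul_assoc (A * b₁), ← zpow_add₀ hc]
        exact hAb _ (by push_cast at h1; omega) (by omega)
  · rw [if_neg (by simp; omega)]
    apply Finset.sum_eq_zero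
    rintro ⟨j, hj⟩ _
    by_cases h : r ≤ j
    · have : ¬ j ≤ s := by omega
      simp [UstarMat, this]
    · simp [Umat, h]
end
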